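/- Let n ≥ 1 and let v be of class C¹ on a neighborhood of the closed unit ball of ℂⁿ. Then ∫_{𝕊ₙ} v(w) dσ(w)/σ_{2n−1} = v(0) + (1/n)·∫_{𝔹ₙ} |w|^{−2n}·(R̄v)(w) dλ_0(w). -/

import Mathlib

open MeasureTheory

noncomputable instance {n : ℕ} : InnerProductSpace ℝ (EuclideanSpace ℂ (Fin n)) :=
  InnerProductSpace.complexToReal

noncomputable instance {n : ℕ} : MeasurableSpace (EuclideanSpace ℂ (Fin n)) := borel _

instance {n : ℕ} : BorelSpace (EuclideanSpace ℂ (Fin n)) := ⟨rfl⟩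

/-- The Euler Beta function `B(x,y) = Γ(x)Γ(y)/Γ(x+y)`. -/
noncomputable def Bfun (x y : ℝ) : ℝ := Real.Gamma x * Real.Gamma y / Real.Gamma (x + y)

/-- The probability measure `dλ_t(z) = ((n−1)!/(πⁿ B(n,t+1)))(1−|z|²)^t dm(z)` on `𝔹ₙ`. -/
noncomputable def lambdaMeasure (n : ℕ) (t : ℝ) : Measure (EuclideanSpace ℂ (Fin n)) :=
  ((volume : Measure (EuclideanSpace ℂ (Fin n))).restrict (Metric.ball 0 1)).withDensity
    fun z => ENNReal.ofReal
      ((Nat.factorial (n - 1) : ℝ) / (Real.pi ^ n * Bfun n (t + 1)) * (1 - ‖z‖ ^ 2) ^ t)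

/-- The `j`-th Wirtinger derivative `∂̄_j v(z) = ½(∂v/∂x_j + i ∂v/∂y_j)`. -/
noncomputable def wdbar {n : ℕ} (v : EuclideanSpace ℂ (Fin n) → ℂ) (j : Fin n)
    (z : EuclideanSpace ℂ (Fin n)) : ℂ :=
  (1 / 2 : ℂ) * (fderiv ℝ v z (EuclideanSpace.single j 1) +
    Complex.I * fderiv ℝ v z (EuclideanSpace.single j Complex.I))

/-- `R̄v(z) = ∑_j conj(z_j) ∂̄_j v(z)`. -/
noncomputable def Rbar {n : ℕ} (v : EuclideanSpace ℂ (Fin n) → ℂ)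
    (z : EuclideanSpace ℂ (Fin n)) : ℂ :=
  ∑ j, (starRingEnd ℂ) (z j) * wdbar v j z

/-- The total surface measure `σ_{2n−1} = 2πⁿ/(n−1)!` of the unit sphere. -/
noncomputable def sigmaTot (n : ℕ) : ℝ := 2 * Real.pi ^ n / (Nat.factorial (n - 1) : ℝ)

section helper
open Set Metric Measure

variable {E : Type*} [NormedAddCommGroup E] [NormedSpace ℝ E] [MeasurableSpace E] [BorelSpace E]
  [FiniteDimensional ℝ E]

lemma aux_int_weight [Nontrivial E] (μ : Measure E) [μ.IsAddHaarMeasure] :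
    IntegrableOn (fun w : E => ‖w‖ ^ (-(Module.finrank ℝ E : ℝ)) * ‖w‖) (ball 0 1) μ := by
  have := (integrableOn_fun_norm_addHaar (E := E) μ
    (f := fun y : ℝ => y ^ (-(Module.finrank ℝ E : ℝ)) * y) (r := 1)).2
  apply this
  have h1 : IntegrableOn (fun _ : ℝ => (1 : ℝ)) (Ioo 0 1) volume := by simp
  refine h1.congr_fun (fun y hy => ?_) measurableSet_Ioo
  have hd : 0 < Module.finrank ℝ E := Module.finrank_pos
  have hy0 := hy.1
  simp only [smul_eq_mul]
  rw [Real.rpow_neg hy0.le, Real.rpow_natCast]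
  obtain ⟨k, hk⟩ := Nat.exists_eq_succ_of_ne_zero hd.ne'
  rw [hk]
  simp only [Nat.succ_eq_add_one, Nat.add_sub_cancel]
  field_simp
  ring

lemma aux_meas {α : Type*} [MeasurableSpace α] (v : E → ℂ) {a b : α → E} (ha : Measurable a)
    (hb : Measurable b) : Measurable (fun p => fderiv ℝ v (a p) (b p)) := by
  have h1 : Measurable (fun p => (fderiv ℝ v (a p), b p)) :=
    ((measurable_fderiv ℝ v).comp ha).prodMk hb
  have h2 : Measurable (fun q : (E →L[ℝ] ℂ) × E => q.1 q.2) :=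
    (isBoundedBilinearMap_apply.continuous).measurable
  exact h2.comp h1

lemma aux_polar (μ : Measure E) [μ.IsAddHaarMeasure] [Nontrivial E] (f : E → ℂ) (hf : Integrable f μ) :
    ∫ x, f x ∂μ = ∫ ζ : sphere (0 : E) 1, ∫ r in Ioi (0 : ℝ),
      r ^ (Module.finrank ℝ E - 1) • f (r • (ζ : E)) ∂volume ∂μ.toSphere := by
  have mp := μ.measurePreserving_homeomorphUnitSphereProd
  let g : sphere (0 : E) 1 × Ioi (0 : ℝ) → ℂ := fun p => f ((p.2 : ℝ) • (p.1 : E))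
  have hg : ∀ x : ({(0)}ᶜ : Set E), g (homeomorphUnitSphereProd E x) = f x := by
    intro x
    have hx : ‖(x : E)‖ ≠ 0 := norm_ne_zero_iff.2 x.2
    simp [g, smul_smul, hx]
  have hint : Integrable g (μ.toSphere.prod (.volumeIoiPow (Module.finrank ℝ E - 1))) := by
    rw [← mp.integrable_comp_emb (Homeomorph.measurableEmbedding _)]
    have h2 : IntegrableOn f ({0}ᶜ : Set E) μ := hf.integrableOn
    rw [integrableOn_iff_comap_subtypeVal (by measurability)] at h2
    exact h2.congr (.of_forall fun x => (hg x).symm)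
  calc
    ∫ x, f x ∂μ = ∫ x : ({(0)}ᶜ : Set E), f x ∂(μ.comap (↑)) := by
      rw [integral_subtype_comap (measurableSet_singleton _).compl f,
        restrict_compl_singleton]
    _ = ∫ x, g x ∂μ.toSphere.prod (.volumeIoiPow (Module.finrank ℝ E - 1)) := by
      rw [← mp.integral_comp (Homeomorph.measurableEmbedding _) g]
      exact integral_congr_ae (.of_forall fun x => (hg x).symm)
    _ = _ := by
      rw [integral_prod _ hint]
      congr 1
      ext ζ
      simp only [Measure.volumeIoiPow, ENNReal.ofReal, g]
      rw [integral_withDensity_eq_integral_smul,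
        integral_subtype_comap measurableSet_Ioi fun a ↦ Real.toNNReal (a ^ (Module.finrank ℝ E - 1)) • f (a • (ζ : E)),
        setIntegral_congr_fun measurableSet_Ioi fun x hx ↦ ?_]
      · rw [NNReal.smul_def, Real.coe_toNNReal _ (pow_nonneg hx.out.le _)]
      · exact (measurable_subtype_coe.pow_const _).real_toNNReal

lemma aux_bound (v : E → ℂ) {U : Set E} (hU : IsOpen U) (hB : closedBall (0 : E) 1 ⊆ U)
    (hv : ContDiffOn ℝ 1 v U) : ∃ C : ℝ, ∀ w ∈ closedBall (0 : E) 1, ‖fderiv ℝ v w‖ ≤ C :=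
  (isCompact_closedBall (0 : E) 1).exists_bound_of_continuousOn
    ((hv.continuousOn_fderiv_of_isOpen hU le_rfl).mono hB)

lemma aux_intble [Nontrivial E] (μ : Measure E) [μ.IsAddHaarMeasure] (v : E → ℂ) {U : Set E} (hU : IsOpen U)
    (hB : closedBall (0 : E) 1 ⊆ U) (hv : ContDiffOn ℝ 1 v U) (b : E → E) (hb : Measurable b)
    (hn : ∀ w, ‖b w‖ = ‖w‖) :
    IntegrableOn (fun w : E => ‖w‖ ^ (-(Module.finrank ℝ E : ℝ)) • fderiv ℝ v w (b w))
      (ball 0 1) μ := by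
  obtain ⟨C, hC⟩ := aux_bound v hU hB hv
  refine Integrable.mono' ((aux_int_weight μ).const_mul C) ?_ ?_
  · exact ((measurable_norm.pow_const _).smul (aux_meas v measurable_id hb)).aestronglyMeasurable
  · filter_upwards [ae_restrict_mem measurableSet_ball] with w hw
    rw [norm_smul, Real.norm_of_nonneg (by positivity)]
    have := (fderiv ℝ v w).le_of_opNorm_le (hC w (ball_subset_closedBall hw)) (b w)
    rw [hn] at this
    calc _ ≤ ‖w‖ ^ (-(Module.finrank ℝ E : ℝ)) * (C * ‖w‖) := by gcongr
      _ = _ := by ring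

lemma aux_radial [Nontrivial E] (μ : Measure E) [μ.IsAddHaarMeasure] (v : E → ℂ) {U : Set E} (hU : IsOpen U)
    (hB : closedBall (0 : E) 1 ⊆ U) (hv : ContDiffOn ℝ 1 v U) :
    ∫ w in ball (0 : E) 1, ‖w‖ ^ (-(Module.finrank ℝ E : ℝ)) • fderiv ℝ v w w ∂μ =
      ∫ ζ : sphere (0 : E) 1, (v ζ - v 0) ∂μ.toSphere := by
  have hi := aux_intble μ v hU hB hv (fun w => w) measurable_id (fun _ => rfl)
  rw [← integral_indicator measurableSet_ball,
    aux_polar μ _ ((integrable_indicator_iff measurableSet_ball).2 hi)]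
  congr 1
  ext ζ
  have hζ : ‖(ζ : E)‖ = 1 := by simp
  have hmem : ∀ r ∈ Icc (0 : ℝ) 1, r • (ζ : E) ∈ U := fun r hr => hB (by
    simp [norm_smul, hζ, abs_of_nonneg hr.1, hr.2])
  have e1 : ∀ r ∈ Ioi (0 : ℝ), r ^ (Module.finrank ℝ E - 1) •
      (ball (0 : E) 1).indicator (fun w => ‖w‖ ^ (-(Module.finrank ℝ E : ℝ)) • fderiv ℝ v w w)
        (r • (ζ : E)) = (Iio (1 : ℝ)).indicator (fun r => fderiv ℝ v (r • (ζ : E)) ζ) r := by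
    intro r (hr : 0 < r)
    have hnr : ‖r • (ζ : E)‖ = r := by simp [norm_smul, hζ, abs_of_pos hr]
    by_cases h1 : r < 1
    · rw [indicator_of_mem (by simpa [hnr] using h1), indicator_of_mem (by simpa using h1), hnr,
        map_smul, smul_smul, smul_smul, Real.rpow_neg hr.le, Real.rpow_natCast]
      have hd : 0 < Module.finrank ℝ E := Module.finrank_pos
      obtain ⟨k, hk⟩ := Nat.exists_eq_succ_of_ne_zero hd.ne'
      rw [hk]
      simp only [Nat.succ_eq_add_one, Nat.add_sub_cancel]
      have : r ^ k * ((r ^ (k + 1))⁻¹ * r) = 1 := by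
        field_simp
        ring
      rw [mul_assoc, this, one_smul]
    · rw [indicator_of_notMem (by simpa [hnr] using h1), indicator_of_notMem (by simpa using h1),
        smul_zero]
  rw [setIntegral_congr_fun measurableSet_Ioi e1, setIntegral_indicator measurableSet_Iio,
    Ioi_inter_Iio, ← integral_Ioc_eq_integral_Ioo,
    ← intervalIntegral.integral_of_le zero_le_one]
  have hder : ∀ r ∈ uIcc (0 : ℝ) 1, HasDerivAt (fun r : ℝ => v (r • (ζ : E)))
      (fderiv ℝ v (r • (ζ : E)) ζ) r := by
    intro r hr
    rw [uIcc_of_le zero_le_one] at hr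
    have h1 : HasFDerivAt v (fderiv ℝ v (r • (ζ : E))) (r • (ζ : E)) :=
      ((hv.contDiffAt (hU.mem_nhds (hmem r hr))).differentiableAt (by simp)).hasFDerivAt
    have h2 : HasDerivAt (fun r : ℝ => r • (ζ : E)) (ζ : E) r := by
      simpa using (hasDerivAt_id r).smul_const (ζ : E)
    exact h1.comp_hasDerivAt r h2
  have hc : ContinuousOn (fun r : ℝ => fderiv ℝ v (r • (ζ : E)) (ζ : E)) (uIcc 0 1) := by
    rw [uIcc_of_le zero_le_one]
    refine ContinuousOn.clm_apply ?_ continuousOn_const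
    exact (hv.continuousOn_fderiv_of_isOpen hU le_rfl).comp (by fun_prop) hmem
  rw [intervalIntegral.integral_eq_sub_of_hasDerivAt hder hc.intervalIntegrable]
  simp

lemma aux_tang [Nontrivial E] [NormedSpace ℂ E] [IsScalarTower ℝ ℂ E]
    (μ : Measure E) [μ.IsAddHaarMeasure]
    (hμ : ∀ θ : ℝ, MeasurePreserving (fun w : E => Complex.exp (θ * Complex.I) • w) μ μ)
    (v : E → ℂ) {U : Set E} (hU : IsOpen U)
    (hB : closedBall (0 : E) 1 ⊆ U) (hv : ContDiffOn ℝ 1 v U) :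
    ∫ w in ball (0 : E) 1, ‖w‖ ^ (-(Module.finrank ℝ E : ℝ)) • fderiv ℝ v w (Complex.I • w) ∂μ
      = 0 := by
  set d : ℝ := -(Module.finrank ℝ E : ℝ) with hd
  let e : ℝ → ℂ := fun θ => Complex.exp (θ * Complex.I)
  have he : ∀ θ, ‖e θ‖ = 1 := fun θ => Complex.norm_exp_ofReal_mul_I θ
  have hec : Continuous e := by fun_prop
  let F : E → ℂ := (ball (0 : E) 1).indicator
    (fun w => ‖w‖ ^ d • fderiv ℝ v w (Complex.I • w))
  have hrot : ∀ θ, ∫ w, F (e θ • w) ∂μ = ∫ w, F w ∂μ := by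
    intro θ
    refine (hμ θ).integral_comp ?_ F
    have hz : e θ ≠ 0 := Complex.exp_ne_zero _
    exact (Homeomorph.smulOfNeZero (e θ) hz).measurableEmbedding
  rw [← integral_indicator measurableSet_ball]
  change ∫ w, F w ∂μ = 0
  obtain ⟨C, hC⟩ := aux_bound v hU hB hv
  have hFm : Measurable F := by
    refine Measurable.indicator ?_ measurableSet_ball
    exact (measurable_norm.pow_const _).smul
      (aux_meas v measurable_id (measurable_const_smul Complex.I))
  have hprod : Integrable (fun p : ℝ × E => F (e p.1 • p.2))
      ((volume.restrict (Ioc 0 (2 * Real.pi))).prod μ) := by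
    have hw : Integrable ((ball (0 : E) 1).indicator fun w : E => C * (‖w‖ ^ d * ‖w‖)) μ :=
      (integrable_indicator_iff measurableSet_ball).2 ((aux_int_weight μ).const_mul C)
    have := hw.comp_snd (volume.restrict (Ioc 0 (2 * Real.pi)))
    refine this.mono' ?_ (.of_forall fun p => ?_)
    · refine (hFm.comp ?_).aestronglyMeasurable
      exact Continuous.measurable (by fun_prop)
    · have hn : ‖e p.1 • p.2‖ = ‖p.2‖ := by rw [norm_smul, he, one_mul]
      by_cases hp : p.2 ∈ ball (0 : E) 1
      · have hp' : e p.1 • p.2 ∈ ball (0 : E) 1 := by simpa [hn] using hp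
        simp only [F]
        rw [indicator_of_mem hp', indicator_of_mem hp, norm_smul, hn,
          Real.norm_of_nonneg (by positivity)]
        have := (fderiv ℝ v (e p.1 • p.2)).le_of_opNorm_le
          (hC _ (ball_subset_closedBall hp')) (Complex.I • e p.1 • p.2)
        rw [norm_smul, hn, Complex.norm_I, one_mul] at this
        calc _ ≤ ‖p.2‖ ^ d * (C * ‖p.2‖) := by gcongr
          _ = _ := by ring
      · have hp' : e p.1 • p.2 ∉ ball (0 : E) 1 := by simpa [hn] using hp
        simp only [F]
        rw [indicator_of_notMem hp', indicator_of_notMem hp, norm_zero]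
  have hswap := integral_integral_swap (f := fun θ w => F (e θ • w)) hprod
  have hinner : ∀ w : E, ∫ θ in Ioc 0 (2 * Real.pi), F (e θ • w) = 0 := by
    intro w
    have hn : ∀ θ, ‖e θ • w‖ = ‖w‖ := fun θ => by rw [norm_smul, he, one_mul]
    by_cases hw : w ∈ ball (0 : E) 1
    · have hw' : ∀ θ, e θ • w ∈ ball (0 : E) 1 := fun θ => by simpa [hn] using hw
      have hwU : ∀ θ, e θ • w ∈ U := fun θ => hB (ball_subset_closedBall (hw' θ))
      have h1 : ∀ θ, F (e θ • w) = ‖w‖ ^ d • fderiv ℝ v (e θ • w) (Complex.I • e θ • w) := by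
        intro θ
        simp only [F]
        rw [indicator_of_mem (hw' θ), hn]
      simp_rw [h1]
      rw [integral_smul, ← intervalIntegral.integral_of_le (by positivity)]
      have hder : ∀ θ ∈ uIcc 0 (2 * Real.pi), HasDerivAt (fun θ : ℝ => v (e θ • w))
          (fderiv ℝ v (e θ • w) (Complex.I • e θ • w)) θ := by
        intro θ _
        have h1 : HasFDerivAt v (fderiv ℝ v (e θ • w)) (e θ • w) :=
          ((hv.contDiffAt (hU.mem_nhds (hwU θ))).differentiableAt (by simp)).hasFDerivAt
        have h3 : HasDerivAt e (Complex.I * e θ) θ := by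
          have h4 : HasDerivAt (fun t : ℝ => (t : ℂ) * Complex.I) Complex.I θ := by
            simpa using (Complex.ofRealCLM.hasDerivAt (x := θ)).mul_const Complex.I
          simpa [e, mul_comm] using h4.cexp
        have h2 : HasDerivAt (fun r : ℝ => e r • w) (Complex.I • e θ • w) θ := by
          rw [smul_smul]
          exact h3.smul_const w
        exact h1.comp_hasDerivAt θ h2
      have hc : ContinuousOn (fun θ : ℝ => fderiv ℝ v (e θ • w) (Complex.I • e θ • w))
          (uIcc 0 (2 * Real.pi)) := by
        refine ContinuousOn.clm_apply ?_ (by fun_prop)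
        exact (hv.continuousOn_fderiv_of_isOpen hU le_rfl).comp (by fun_prop) (fun θ _ => hwU θ)
      rw [intervalIntegral.integral_eq_sub_of_hasDerivAt hder hc.intervalIntegrable]
      simp [e]
    · have hw' : ∀ θ, e θ • w ∉ ball (0 : E) 1 := fun θ => by simpa [hn] using hw
      have h1 : ∀ θ, F (e θ • w) = 0 := fun θ => indicator_of_notMem (hw' θ) _
      simp [h1]
  simp_rw [hrot, hinner] at hswap
  simp only [integral_const, smul_zero, smul_eq_zero] at hswap
  rcases hswap with h | h
  · exfalso
    simp [Measure.real, Real.pi_pos.le, Real.pi_ne_zero] at h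
  · exact h

end helper

lemma aux_expand {n : ℕ} (z : EuclideanSpace ℂ (Fin n)) (c : ℂ) :
    c • z = ∑ j, ((c * z j).re • EuclideanSpace.single j (1 : ℂ) +
      (c * z j).im • EuclideanSpace.single j Complex.I) := by
  ext i
  simp only [PiLp.smul_apply, WithLp.ofLp_sum, Finset.sum_apply, PiLp.add_apply,
    EuclideanSpace.single_apply, smul_eq_mul]
  rw [Finset.sum_eq_single i]
  · simp only [if_true, Complex.real_smul, mul_one]
    exact (Complex.re_add_im _).symm
  · intro b _ hb
    simp [hb.symm]
  · simp

lemma aux_Rbar {n : ℕ} (v : EuclideanSpace ℂ (Fin n) → ℂ) (z : EuclideanSpace ℂ (Fin n)) :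
    Rbar v z = (1 / 2 : ℂ) * (fderiv ℝ v z z + Complex.I * fderiv ℝ v z (Complex.I • z)) := by
  have h1 : fderiv ℝ v z z = ∑ j, (((z j).re : ℂ) * fderiv ℝ v z (EuclideanSpace.single j (1 : ℂ)) +
      ((z j).im : ℂ) * fderiv ℝ v z (EuclideanSpace.single j Complex.I)) := by
    have := congrArg (fderiv ℝ v z) (aux_expand z 1)
    simpa only [one_smul, one_mul, map_sum, map_add, map_smul, Complex.real_smul] using this
  have h2 : fderiv ℝ v z (Complex.I • z) = ∑ j, (-((z j).im : ℂ) *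
      fderiv ℝ v z (EuclideanSpace.single j (1 : ℂ)) +
      ((z j).re : ℂ) * fderiv ℝ v z (EuclideanSpace.single j Complex.I)) := by
    have := congrArg (fderiv ℝ v z) (aux_expand z Complex.I)
    simpa only [Complex.I_mul_re, Complex.I_mul_im, Complex.ofReal_neg, map_sum, map_add, map_smul,
      Complex.real_smul] using this
  rw [h1, h2, Rbar, Finset.mul_sum, ← Finset.sum_add_distrib, Finset.mul_sum]
  refine Finset.sum_congr rfl fun j _ => ?_
  have hc : (starRingEnd ℂ) (z j) = ((z j).re : ℂ) - ((z j).im : ℂ) * Complex.I := by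
    apply Complex.ext <;> simp
  rw [hc, wdbar]
  linear_combination (-(1 / 2 : ℂ) * ((z j).im : ℂ) *
    fderiv ℝ v z (EuclideanSpace.single j Complex.I)) * Complex.I_mul_I

lemma aux_finrank (n : ℕ) : Module.finrank ℝ (EuclideanSpace ℂ (Fin n)) = 2 * n := by
  rw [← Module.finrank_mul_finrank ℝ ℂ]; simp

lemma aux_rot {n : ℕ} (θ : ℝ) :
    MeasurePreserving (fun w : EuclideanSpace ℂ (Fin n) => Complex.exp (θ * Complex.I) • w)
      volume volume := by
  let L : EuclideanSpace ℂ (Fin n) ≃ₗᵢ[ℝ] EuclideanSpace ℂ (Fin n) :=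
    { toLinearEquiv := (LinearEquiv.smulOfNeZero ℂ (EuclideanSpace ℂ (Fin n))
        (Complex.exp (θ * Complex.I)) (Complex.exp_ne_zero _)).restrictScalars ℝ
      norm_map' := fun x => by
        change ‖Complex.exp (θ * Complex.I) • x‖ = ‖x‖
        rw [norm_smul, Complex.norm_exp_ofReal_mul_I, one_mul] }
  exact L.measurePreserving

lemma aux_lambda {n : ℕ} (hn : 1 ≤ n) (f : EuclideanSpace ℂ (Fin n) → ℂ) :
    ∫ w, f w ∂(lambdaMeasure n 0) =
      ((n.factorial : ℝ) / Real.pi ^ n) • ∫ w in Metric.ball 0 1, f w := by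
  have hB : Bfun n (0 + 1) = (n : ℝ)⁻¹ := by
    have h0 : (n : ℝ) ≠ 0 := by positivity
    have h1 : Real.Gamma n ≠ 0 := (Real.Gamma_pos_of_pos (by positivity)).ne'
    rw [Bfun, zero_add, Real.Gamma_one, Real.Gamma_add_one h0]
    field_simp
  have hf : (n.factorial : ℝ) = n * ((n - 1).factorial : ℝ) := by
    exact_mod_cast (Nat.mul_factorial_pred (by omega)).symm
  have hc : ((n - 1).factorial : ℝ) / (Real.pi ^ n * Bfun n (0 + 1)) =
      (n.factorial : ℝ) / Real.pi ^ n := by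
    have h0 : (n : ℝ) ≠ 0 := by positivity
    rw [hB, hf]
    field_simp
  unfold lambdaMeasure
  simp only [Real.rpow_zero, mul_one, hc]
  rw [withDensity_const, integral_smul_measure, ENNReal.toReal_ofReal (by positivity)]

/-- Integration by parts from the unit sphere into the ball (Lemma 7.7):
`∫_{𝕊ₙ} v dσ/σ_{2n−1} = v(0) + (1/n) ∫_{𝔹ₙ} |w|^{−2n} R̄v(w) dλ_0(w)`. -/
theorem stmt16 (n : ℕ) (hn : 1 ≤ n) (v : EuclideanSpace ℂ (Fin n) → ℂ)
    (hv : ∃ U : Set (EuclideanSpace ℂ (Fin n)), IsOpen U ∧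
      Metric.closedBall (0 : EuclideanSpace ℂ (Fin n)) 1 ⊆ U ∧ ContDiffOn ℝ 1 v U) :
    (sigmaTot n)⁻¹ •
        (∫ w : Metric.sphere (0 : EuclideanSpace ℂ (Fin n)) 1,
          v (w : EuclideanSpace ℂ (Fin n))
          ∂((volume : Measure (EuclideanSpace ℂ (Fin n))).toSphere))
      = v 0 + ((n : ℝ)⁻¹) •
          ∫ w, (‖w‖ ^ (-(2 * (n : ℝ)))) • Rbar v w ∂(lambdaMeasure n 0) := by
  obtain ⟨U, hU, hB, hv⟩ := hv
  have hnt : Nontrivial (EuclideanSpace ℂ (Fin n)) :=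
    Module.nontrivial_of_finrank_pos (R := ℝ) (by rw [aux_finrank]; omega)
  have hd : ((Module.finrank ℝ (EuclideanSpace ℂ (Fin n)) : ℕ) : ℝ) = 2 * (n : ℝ) := by
    rw [aux_finrank]; push_cast; ring
  have hI1 := aux_intble (volume : Measure (EuclideanSpace ℂ (Fin n))) v hU hB hv
    (fun w => w) measurable_id (fun _ => rfl)
  have hI2 := aux_intble (volume : Measure (EuclideanSpace ℂ (Fin n))) v hU hB hv
    (fun w => Complex.I • w) (measurable_const_smul Complex.I) (fun w => by simp [norm_smul])
  have hR := aux_radial (volume : Measure (EuclideanSpace ℂ (Fin n))) v hU hB hv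
  have hT := aux_tang (volume : Measure (EuclideanSpace ℂ (Fin n))) aux_rot v hU hB hv
  rw [hd] at hI1 hI2 hR hT
  have hsum : ∫ w in Metric.ball (0 : EuclideanSpace ℂ (Fin n)) 1,
      (‖w‖ ^ (-(2 * (n : ℝ)))) • Rbar v w =
      (1 / 2 : ℂ) * ∫ ζ : Metric.sphere (0 : EuclideanSpace ℂ (Fin n)) 1, (v ζ - v 0)
        ∂((volume : Measure (EuclideanSpace ℂ (Fin n))).toSphere) := by
    have e : ∀ w : EuclideanSpace ℂ (Fin n), (‖w‖ ^ (-(2 * (n : ℝ)))) • Rbar v w =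
        (1 / 2 : ℂ) * ((‖w‖ ^ (-(2 * (n : ℝ)))) • fderiv ℝ v w w) +
        (1 / 2 * Complex.I : ℂ) * ((‖w‖ ^ (-(2 * (n : ℝ)))) • fderiv ℝ v w (Complex.I • w)) := by
      intro w
      rw [aux_Rbar]
      simp only [Complex.real_smul]
      ring
    simp_rw [e]
    rw [integral_add (hI1.const_mul _) (hI2.const_mul _), integral_const_mul, integral_const_mul,
      hR, hT, mul_zero, add_zero]
  have hvi : Integrable (fun ζ : Metric.sphere (0 : EuclideanSpace ℂ (Fin n)) 1 => v ζ)
      ((volume : Measure (EuclideanSpace ℂ (Fin n))).toSphere) := by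
    have hc : Continuous (fun ζ : Metric.sphere (0 : EuclideanSpace ℂ (Fin n)) 1 => v ζ) :=
      hv.continuousOn.comp_continuous continuous_subtype_val
        (fun ζ => hB (Metric.sphere_subset_closedBall ζ.2))
    exact hc.integrable_of_hasCompactSupport (HasCompactSupport.of_compactSpace _)
  have hf : (n.factorial : ℝ) = n * ((n - 1).factorial : ℝ) := by
    exact_mod_cast (Nat.mul_factorial_pred (by omega)).symm
  have h0 : (n : ℝ) ≠ 0 := by positivity
  have htot : ((volume : Measure (EuclideanSpace ℂ (Fin n))).toSphere).real Set.univ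
      = sigmaTot n := by
    rw [Measure.toSphere_real_apply_univ, hd, Measure.real,
      InnerProductSpace.volume_ball_of_dim_even (aux_finrank n), sigmaTot]
    simp only [ENNReal.ofReal_one, one_pow, one_mul]
    rw [ENNReal.toReal_ofReal (by positivity), hf]
    field_simp
  have hs0 : sigmaTot n ≠ 0 := by unfold sigmaTot; positivity
  have hconst : (n : ℝ)⁻¹ * ((n.factorial : ℝ) / Real.pi ^ n) * (1 / 2) = (sigmaTot n)⁻¹ := by
    rw [hf, sigmaTot]
    field_simp
  rw [aux_lambda hn, hsum, integral_sub hvi (integrable_const _), integral_const, htot]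
  have hconst' := congrArg (fun x : ℝ => (x : ℂ)) hconst
  have hs0' : (sigmaTot n : ℂ) ≠ 0 := by exact_mod_cast hs0
  simp only [Complex.real_smul]
  push_cast at hconst' ⊢
  generalize (∫ ζ : Metric.sphere (0 : EuclideanSpace ℂ (Fin n)) 1, v ζ
        ∂((volume : Measure (EuclideanSpace ℂ (Fin n))).toSphere)) = S at *
  have hk : (sigmaTot n : ℂ)⁻¹ * sigmaTot n = 1 := inv_mul_cancel₀ hs0'
  linear_combination -(S - sigmaTot n * v 0) * hconst' + v 0 * hk
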